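/- Let q ∈ ℕ, φ ∈ (0,1), K = ⌈log₂(1/φ)⌉ and s = 2^{−(K+1)}. Let η be sampled uniformly from the points of the grid {0, s, 2s, …}^q ∩ [0,1]^q, and for each k let Q^k(η) be the partition of [0,1]^q into axis-aligned boxes of side length (at most) 2^{−k} induced by the grid of mesh 2^{−k} centered at η (in each coordinate i, the cut points are η_i + m·2^{−k}, m ∈ ℤ, intersected with (0,1)). Then for all Borel probability measures μ, ν on [0,1]^q: E_η [ Σ_{k=1}^{K+1} 2^{−k} Σ_{C ∈ Q^k(η)} |μ(C) − ν(C)| ] ≤ (K+1)·4q·( W1(μ,ν)/√q + 2^{−(K+1)} ). -/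

import Mathlib

open MeasureTheory

noncomputable section

/-- A coupling of `μ` and `ν`: a measure on the product whose marginals are `μ` and `ν`. -/
def IsCoupling {α β : Type*} [MeasurableSpace α] [MeasurableSpace β]
    (γ : Measure (α × β)) (μ : Measure α) (ν : Measure β) : Prop :=
  γ.map Prod.fst = μ ∧ γ.map Prod.snd = ν

/-- The optimal transport cost between `μ` and `ν` for the cost function `cost`. -/
def transportCost {α β : Type*} [MeasurableSpace α] [MeasurableSpace β]
    (cost : α → β → ℝ) (μ : Measure α) (ν : Measure β) : ℝ :=
  sInf {c : ℝ | ∃ γ : Measure (α × β), IsProbabilityMeasure γ ∧ IsCoupling γ μ ν ∧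
    c = ∫ z, cost z.1 z.2 ∂γ}

/-- Wasserstein-1 distance on `ℝ^q` (represented as `Fin q → ℝ`) with Euclidean cost. -/
def W1E (q : ℕ) (μ ν : Measure (Fin q → ℝ)) : ℝ :=
  transportCost (fun x y => Real.sqrt (∑ i, (x i - y i) ^ 2)) μ ν

/-- The unit cube `[0,1]^q`. -/
def unitCube (q : ℕ) : Set (Fin q → ℝ) := Set.univ.pi fun _ => Set.Icc 0 1

/-- The cell of the axis-aligned grid `Q^k(η)` on `[0,1]^q` with index `v ∈ ℤ^q`: the grid
has mesh `2⁻ᵏ` and in coordinate `i` the cut points are `η i + m·2⁻ᵏ`, `m ∈ ℤ`. -/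
def gridCellQ (q : ℕ) (k : ℕ) (η : Fin q → ℝ) (v : Fin q → ℤ) : Set (Fin q → ℝ) :=
  {x | x ∈ unitCube q ∧ ∀ i, ⌊(2 : ℝ) ^ k * (x i - η i)⌋ = v i}


lemma count_aux (k M : ℕ) (hM : 0 < M) (j : ℤ) :
    ((Finset.univ : Finset (Fin (2^k*M+1))).filter (fun b : Fin _ => (M:ℤ) ∣ j - (b:ℕ))).card ≤ 2^k+1 := by
  have h := Int.Ioc_filter_modEq_card (-1) ((2^k*M : ℕ):ℤ) (r := (M:ℤ)) (by exact_mod_cast hM) j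
  have h2 : ((Finset.univ : Finset (Fin (2^k*M+1))).filter (fun b : Fin _ => (M:ℤ) ∣ j - (b:ℕ))).card
      ≤ ((Finset.Ioc (-1:ℤ) ((2^k*M : ℕ):ℤ)).filter (fun x => x ≡ j [ZMOD (M:ℤ)])).card := by
    apply Finset.card_le_card_of_injOn (fun b : Fin (2^k*M+1) => ((b:ℕ):ℤ))
    · intro b hb
      have hb2 := b.2
      simp only [Finset.coe_filter, Finset.mem_univ, true_and, Set.mem_ofPred_eq, Finset.mem_Ioc] at hb ⊢
      refine ⟨⟨by omega, by exact_mod_cast (by omega : (b:ℕ) ≤ 2^k*M)⟩, ?_⟩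
      exact Int.modEq_iff_dvd.2 hb
    · intro a _ b _ hab
      apply Fin.ext
      simpa using hab
  have hMq : (0:ℚ) < M := by exact_mod_cast hM
  have h3 : ⌊((((2^k*M : ℕ):ℤ):ℚ) - (j:ℚ)) / ((M:ℤ):ℚ)⌋ ≤ ⌊(((-1:ℤ):ℚ) - (j:ℚ)) / ((M:ℤ):ℚ)⌋ + ((2^k+1 : ℕ):ℤ) := by
    rw [← Int.floor_add_natCast]
    apply Int.floor_le_floor
    push_cast
    rw [div_add' _ _ _ hMq.ne', div_le_div_iff_of_pos_right hMq]
    have : (1:ℚ) ≤ M := by exact_mod_cast hM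
    linarith
  refine h2.trans ?_
  rw [← Nat.cast_le (α := ℤ), h]
  exact max_le (by linarith) (Int.natCast_nonneg _)

lemma floor_aux (k M : ℕ) (hM : 0 < M) (x : ℝ) (b : ℕ) :
    ⌊(2:ℝ)^k * (x - (b:ℝ)/((2^k*M:ℕ):ℝ))⌋ = (⌊((2^k*M:ℕ):ℝ)*x⌋ - b) / (M:ℤ) := by
  have hM' : (0:ℝ) < M := by exact_mod_cast hM
  have : (2:ℝ)^k * (x - (b:ℝ)/((2^k*M:ℕ):ℝ)) = (((2^k*M:ℕ):ℝ)*x - (b:ℕ)) / (M:ℕ) := by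
    push_cast; field_simp
  rw [this]
  rw [Int.floor_div_natCast, Int.floor_sub_natCast]

lemma sep_count (k M : ℕ) (hM : 0 < M) (x y : ℝ) :
    (((Finset.univ : Finset (Fin (2^k*M+1))).filter (fun b : Fin _ =>
      ⌊(2:ℝ)^k * (x - ((b:ℕ):ℝ)/((2^k*M:ℕ):ℝ))⌋ ≠ ⌊(2:ℝ)^k * (y - ((b:ℕ):ℝ)/((2^k*M:ℕ):ℝ))⌋)).card : ℝ)
      ≤ (2^k+1) * (((2^k*M:ℕ):ℝ) * |x-y| + 1) := by
  wlog hxy : y ≤ x generalizing x y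
  · have := this y x (le_of_not_ge hxy)
    rw [abs_sub_comm] at this
    simpa only [ne_comm] using this
  set N : ℕ := 2^k*M with hN
  simp_rw [hN, floor_aux k M hM, ← hN]
  set X := ⌊(N:ℝ)*x⌋
  set Y := ⌊(N:ℝ)*y⌋
  have hYX : Y ≤ X := Int.floor_le_floor (by gcongr)
  have hXY : ((X - Y : ℤ):ℝ) ≤ N * |x-y| + 1 := by
    rw [abs_of_nonneg (by linarith)]
    have := Int.floor_le ((N:ℝ)*x)
    have := Int.lt_floor_add_one ((N:ℝ)*y)
    push_cast; linarith
  have hsub : (Finset.univ : Finset (Fin (N+1))).filter (fun b : Fin (N+1) => (X - (b:ℕ))/(M:ℤ) ≠ (Y-(b:ℕ))/(M:ℤ))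
      ⊆ (Finset.Ioc Y X).biUnion (fun j => (Finset.univ : Finset (Fin (N+1))).filter (fun b : Fin _ => (M:ℤ) ∣ j - (b:ℕ))) := by
    intro b hb
    simp only [Finset.mem_filter, Finset.mem_univ, true_and, Finset.mem_biUnion, Finset.mem_Ioc] at hb ⊢
    have hMz : (0:ℤ) < M := by exact_mod_cast hM
    have h1 : (Y-(b:ℕ))/(M:ℤ) < (X - (b:ℕ))/(M:ℤ) :=
      lt_of_le_of_ne (Int.ediv_le_ediv hMz (by omega)) (Ne.symm hb)
    refine ⟨b + M * ((X - (b:ℕ))/(M:ℤ)), ⟨?_, ?_⟩, ?_⟩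
    · have := Int.lt_mul_of_ediv_lt hMz h1
      rw [mul_comm] at this
      linarith
    · have := Int.mul_ediv_self_le (x := X - (b:ℕ)) (k := (M:ℤ)) hMz.ne'
      linarith
    · simp
  have hc := (Finset.card_le_card hsub).trans (Finset.card_biUnion_le_card_mul _ _ (2^k+1) (fun j _ => count_aux k M hM j))
  rw [Int.card_Ioc] at hc
  have hc' : ((((Finset.univ : Finset (Fin (N+1))).filter (fun b : Fin (N+1) => (X - (b:ℕ))/(M:ℤ) ≠ (Y-(b:ℕ))/(M:ℤ))).card : ℕ):ℝ) ≤ (((X-Y).toNat * (2^k+1) : ℕ):ℝ) := by exact_mod_cast hc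
  refine hc'.trans ?_
  have : (((X-Y).toNat:ℕ):ℝ) = ((X-Y:ℤ):ℝ) := by
    exact_mod_cast Int.toNat_of_nonneg (by omega : 0 ≤ X - Y)
  push_cast
  rw [this, mul_comm]
  gcongr

lemma tv_le {E V : Type*} [MeasurableSpace E] [Countable V] [MeasurableSpace V] [MeasurableSingletonClass V]
    (γ : Measure (E × E)) [IsProbabilityMeasure γ] (f : E → V) (hf : Measurable f) :
    ∑' v, |((γ.map Prod.fst) (f ⁻¹' {v})).toReal - ((γ.map Prod.snd) (f ⁻¹' {v})).toReal|
      ≤ 2 * γ.real {z | f z.1 ≠ f z.2} := by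
  have hD : MeasurableSet {z : E × E | f z.1 ≠ f z.2} :=
    (measurableSet_eq_fun (hf.comp measurable_fst) (hf.comp measurable_snd)).compl
  set D := {z : E × E | f z.1 ≠ f z.2}
  have h1 : ∀ v, MeasurableSet ((fun z : E × E => f z.1) ⁻¹' {v}) := fun v =>
    (hf.comp measurable_fst) (measurableSet_singleton v)
  have h2 : ∀ v, MeasurableSet ((fun z : E × E => f z.2) ⁻¹' {v}) := fun v =>
    (hf.comp measurable_snd) (measurableSet_singleton v)
  have key : ∀ v, |((γ.map Prod.fst) (f ⁻¹' {v})).toReal - ((γ.map Prod.snd) (f ⁻¹' {v})).toReal|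
      ≤ (γ.restrict D).real ((fun z : E × E => f z.1) ⁻¹' {v}) + (γ.restrict D).real ((fun z : E × E => f z.2) ⁻¹' {v}) := by
    intro v
    rw [Measure.map_apply measurable_fst (hf (measurableSet_singleton v)),
      Measure.map_apply measurable_snd (hf (measurableSet_singleton v))]
    change |γ.real ((fun z : E × E => f z.1) ⁻¹' {v}) - γ.real ((fun z : E × E => f z.2) ⁻¹' {v})| ≤ _
    rw [measureReal_restrict_apply (h1 v), measureReal_restrict_apply (h2 v)]
    rw [← measureReal_inter_add_sdiff (s := (fun z : E × E => f z.1) ⁻¹' {v}) hD,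
      ← measureReal_inter_add_sdiff (s := (fun z : E × E => f z.2) ⁻¹' {v}) hD]
    have : ((fun z : E × E => f z.1) ⁻¹' {v}) \ D = ((fun z : E × E => f z.2) ⁻¹' {v}) \ D := by
      ext z
      simp only [Set.mem_sdiff, Set.mem_preimage, Set.mem_singleton_iff, D, Set.mem_ofPred_eq, not_not]
      constructor
      · rintro ⟨a, b⟩; exact ⟨b ▸ a, b⟩
      · rintro ⟨a, b⟩; exact ⟨b ▸ a, b⟩
    rw [this, abs_le]
    have p1 := measureReal_nonneg (μ := γ) (s := ((fun z : E × E => f z.1) ⁻¹' {v}) ∩ D)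
    have p2 := measureReal_nonneg (μ := γ) (s := ((fun z : E × E => f z.2) ⁻¹' {v}) ∩ D)
    constructor <;> linarith
  apply Real.tsum_le_of_sum_le (fun v => abs_nonneg _)
  intro s
  refine (Finset.sum_le_sum fun v _ => key v).trans ?_
  rw [Finset.sum_add_distrib, sum_measureReal_preimage_singleton s (fun v _ => h1 v),
    sum_measureReal_preimage_singleton s (fun v _ => h2 v)]
  have huniv : (γ.restrict D).real Set.univ = γ.real D := by simp
  have a1 := measureReal_mono (μ := γ.restrict D) (Set.subset_univ ((fun z : E × E => f z.1) ⁻¹' (s : Set V)))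
  have a2 := measureReal_mono (μ := γ.restrict D) (Set.subset_univ ((fun z : E × E => f z.2) ⁻¹' (s : Set V)))
  linarith

lemma avg_aux (q n : ℕ) (h : Fin (n+1) → ℝ) (i : Fin q) :
    (1 / (Fintype.card (Fin q → Fin (n+1)) : ℝ)) * ∑ a : Fin q → Fin (n+1), h (a i) = (1/((n:ℝ)+1)) * ∑ b, h b := by
  have := Fintype.sum_piFinset_apply h Finset.univ i
  simp only [Fintype.piFinset_univ] at this
  rw [this]
  have hq : 0 < q := i.pos
  obtain ⟨r, rfl⟩ : ∃ r, q = r + 1 := ⟨q - 1, by omega⟩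
  have hn : ((n:ℝ)+1) ≠ 0 := by positivity
  simp
  field_simp
  ring

lemma sep_integral (q k M : ℕ) (hM : 0 < M) (γ : Measure ((Fin q → ℝ) × (Fin q → ℝ))) [IsProbabilityMeasure γ]
    (i : Fin q) (hint : Integrable (fun z => |z.1 i - z.2 i|) γ) :
    ∑ b : Fin (2^k*M+1), γ.real {z | ⌊(2:ℝ)^k * (z.1 i - ((b:ℕ):ℝ)/((2^k*M:ℕ):ℝ))⌋ ≠
      ⌊(2:ℝ)^k * (z.2 i - ((b:ℕ):ℝ)/((2^k*M:ℕ):ℝ))⌋}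
    ≤ (2^k+1) * (((2^k*M:ℕ):ℝ) * (∫ z, |z.1 i - z.2 i| ∂γ) + 1) := by
  have hm : ∀ b : Fin (2^k*M+1), MeasurableSet {z : (Fin q → ℝ) × (Fin q → ℝ) | ⌊(2:ℝ)^k * (z.1 i - ((b:ℕ):ℝ)/((2^k*M:ℕ):ℝ))⌋ ≠
      ⌊(2:ℝ)^k * (z.2 i - ((b:ℕ):ℝ)/((2^k*M:ℕ):ℝ))⌋} := fun b =>
    (measurableSet_eq_fun (by fun_prop) (by fun_prop)).compl
  have e : ∀ b : Fin (2^k*M+1), γ.real {z | ⌊(2:ℝ)^k * (z.1 i - ((b:ℕ):ℝ)/((2^k*M:ℕ):ℝ))⌋ ≠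
      ⌊(2:ℝ)^k * (z.2 i - ((b:ℕ):ℝ)/((2^k*M:ℕ):ℝ))⌋} = ∫ z, Set.indicator {z | ⌊(2:ℝ)^k * (z.1 i - ((b:ℕ):ℝ)/((2^k*M:ℕ):ℝ))⌋ ≠
      ⌊(2:ℝ)^k * (z.2 i - ((b:ℕ):ℝ)/((2^k*M:ℕ):ℝ))⌋} (fun _ => (1:ℝ)) z ∂γ := by
    intro b
    rw [integral_indicator (hm b)]
    simp
  rw [Finset.sum_congr rfl (fun b _ => e b), ← integral_finsetSum]
  · have : (2^k+1) * (((2^k*M:ℕ):ℝ) * (∫ z, |z.1 i - z.2 i| ∂γ) + 1) = ∫ z, (2^k+1) * (((2^k*M:ℕ):ℝ) * |z.1 i - z.2 i| + 1) ∂γ := by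
      rw [integral_const_mul, integral_add (hint.const_mul _) (integrable_const _), integral_const_mul]
      simp
    rw [this]
    apply integral_mono_of_nonneg
    · exact Filter.Eventually.of_forall fun z => Finset.sum_nonneg fun b _ => Set.indicator_nonneg (fun _ _ => zero_le_one) _
    · exact ((hint.const_mul _).add (integrable_const _)).const_mul _
    · refine Filter.Eventually.of_forall fun z => ?_
      refine le_trans (le_of_eq ?_) (sep_count k M hM (z.1 i) (z.2 i))
      simp only [Set.indicator_apply, Set.mem_ofPred_eq]
      rw [Finset.sum_boole]
  · intro b _
    exact (integrable_const _).indicator (hm b)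

lemma l1_le (q : ℕ) (x y : Fin q → ℝ) :
    ∑ i, |x i - y i| ≤ Real.sqrt q * Real.sqrt (∑ i, (x i - y i)^2) := by
  rw [← Real.sqrt_mul (by positivity)]
  apply Real.le_sqrt_of_sq_le
  have := sq_sum_le_card_mul_sum_sq (s := (Finset.univ : Finset (Fin q))) (f := fun i => |x i - y i|)
  simpa using this

lemma level_bound (q k N M : ℕ) (hM : 0 < M) (hN : N = 2^k*M)
    (μ ν : Measure (Fin q → ℝ)) [IsProbabilityMeasure μ] [IsProbabilityMeasure ν]
    (hμ : μ (unitCube q) = 1) (hν : ν (unitCube q) = 1)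
    (γ : Measure ((Fin q → ℝ) × (Fin q → ℝ))) [IsProbabilityMeasure γ] (hγ : IsCoupling γ μ ν) :
    (1 / (Fintype.card (Fin q → Fin (N + 1)) : ℝ)) * ∑ a : Fin q → Fin (N+1),
      (1 : ℝ) / 2 ^ k * ∑' v : Fin q → ℤ,
        |(μ (gridCellQ q k (fun i => (a i : ℝ) / (N:ℝ)) v)).toReal -
          (ν (gridCellQ q k (fun i => (a i : ℝ) / (N:ℝ)) v)).toReal| ≤
      4 * (Real.sqrt q * (∫ z, Real.sqrt (∑ i, (z.1 i - z.2 i) ^ 2) ∂γ) + q * (1 / (N:ℝ))) := by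
  have hNpos : (0:ℝ) < N := by
    have : 0 < N := by rw [hN]; positivity
    exact_mod_cast this
  have hcube : MeasurableSet (unitCube q) := MeasurableSet.univ_pi fun _ => measurableSet_Icc
  have aeμ : ∀ᵐ x ∂μ, x ∈ unitCube q := (mem_ae_iff_prob_eq_one hcube).2 hμ
  have aeν : ∀ᵐ x ∂ν, x ∈ unitCube q := (mem_ae_iff_prob_eq_one hcube).2 hν
  have ae1 : ∀ᵐ z ∂γ, z.1 ∈ unitCube q := by
    have := aeμ; rw [← hγ.1] at this; exact ae_of_ae_map measurable_fst.aemeasurable this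
  have ae2 : ∀ᵐ z ∂γ, z.2 ∈ unitCube q := by
    have := aeν; rw [← hγ.2] at this; exact ae_of_ae_map measurable_snd.aemeasurable this
  have aecoord : ∀ᵐ z ∂γ, ∀ i, |z.1 i - z.2 i| ≤ 1 := by
    filter_upwards [ae1, ae2] with z h1 h2 i
    have a := h1 i (Set.mem_univ _)
    have b := h2 i (Set.mem_univ _)
    rw [abs_le]
    constructor <;> linarith [a.1, a.2, b.1, b.2]
  have hint : ∀ i, Integrable (fun z : (Fin q → ℝ) × (Fin q → ℝ) => |z.1 i - z.2 i|) γ := by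
    intro i
    apply Integrable.of_bound (C := 1) (by fun_prop)
    filter_upwards [aecoord] with z hz
    simpa using hz i
  have hintc : Integrable (fun z : (Fin q → ℝ) × (Fin q → ℝ) => Real.sqrt (∑ i, (z.1 i - z.2 i) ^ 2)) γ := by
    apply Integrable.of_bound (C := Real.sqrt q) (by fun_prop)
    filter_upwards [aecoord] with z hz
    rw [Real.norm_of_nonneg (Real.sqrt_nonneg _)]
    apply Real.sqrt_le_sqrt
    calc ∑ i, (z.1 i - z.2 i) ^ 2 ≤ ∑ i : Fin q, (1:ℝ) := by
          refine Finset.sum_le_sum fun i _ => ?_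
          rw [sq_le_one_iff_abs_le_one]; exact hz i
      _ = q := by simp
  set S : Fin q → Fin (N+1) → Set ((Fin q → ℝ) × (Fin q → ℝ)) := fun i b =>
    {z | ⌊(2:ℝ)^k * (z.1 i - ((b:ℕ):ℝ)/(N:ℝ))⌋ ≠ ⌊(2:ℝ)^k * (z.2 i - ((b:ℕ):ℝ)/(N:ℝ))⌋} with hS
  have step1 : ∀ a : Fin q → Fin (N+1), ∑' v : Fin q → ℤ,
        |(μ (gridCellQ q k (fun i => (a i : ℝ) / (N:ℝ)) v)).toReal -
          (ν (gridCellQ q k (fun i => (a i : ℝ) / (N:ℝ)) v)).toReal| ≤ 2 * ∑ i, γ.real (S i (a i)) := by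
    intro a
    let f : (Fin q → ℝ) → (Fin q → ℤ) := fun x i => ⌊(2:ℝ)^k * (x i - ((a i : ℕ):ℝ)/(N:ℝ))⌋
    have hf : Measurable f := by
      refine measurable_pi_lambda _ fun i => ?_
      fun_prop
    have hcell : ∀ v, gridCellQ q k (fun i => (a i : ℝ) / (N:ℝ)) v = f ⁻¹' {v} ∩ unitCube q := by
      intro v
      ext x
      constructor
      · rintro ⟨h1, h2⟩; exact ⟨funext h2, h1⟩
      · rintro ⟨h1, h2⟩; exact ⟨h2, fun i => congrFun h1 i⟩
    have e1 : ∀ v, μ (gridCellQ q k (fun i => (a i : ℝ) / (N:ℝ)) v) = (γ.map Prod.fst) (f ⁻¹' {v}) := by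
      intro v
      rw [hγ.1, hcell]
      rw [Set.inter_comm]
      exact Measure.measure_inter_eq_of_ae aeμ
    have e2 : ∀ v, ν (gridCellQ q k (fun i => (a i : ℝ) / (N:ℝ)) v) = (γ.map Prod.snd) (f ⁻¹' {v}) := by
      intro v
      rw [hγ.2, hcell]
      rw [Set.inter_comm]
      exact Measure.measure_inter_eq_of_ae aeν
    simp_rw [e1, e2]
    refine (tv_le γ f hf).trans ?_
    gcongr
    have hsub : {z : (Fin q → ℝ) × (Fin q → ℝ) | f z.1 ≠ f z.2} ⊆ ⋃ i, S i (a i) := by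
      intro z hz
      obtain ⟨i, hi⟩ := Function.ne_iff.1 hz
      exact Set.mem_iUnion.2 ⟨i, hi⟩
    exact (measureReal_mono hsub).trans (measureReal_iUnion_fintype_le _)
  have step2 : ∀ i, ∑ b, γ.real (S i b) ≤ (2^k+1) * ((N:ℝ) * (∫ z, |z.1 i - z.2 i| ∂γ) + 1) := by
    intro i
    have := sep_integral q k M hM γ i (hint i)
    subst hN
    exact this
  have hk : (0:ℝ) < 2^k := by positivity
  have hk1 : (1:ℝ) ≤ 2^k := one_le_pow₀ (by norm_num)
  have step3 : ∀ i, (1/((N:ℝ)+1)) * ∑ b, γ.real (S i b) ≤ 2 * 2^k * ((∫ z, |z.1 i - z.2 i| ∂γ) + 1 / N) := by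
    intro i
    have hI : 0 ≤ ∫ z, |z.1 i - z.2 i| ∂γ := integral_nonneg fun z => abs_nonneg _
    calc (1/((N:ℝ)+1)) * ∑ b, γ.real (S i b)
        ≤ (1/(N:ℝ)) * ((2^k+2^k) * ((N:ℝ) * (∫ z, |z.1 i - z.2 i| ∂γ) + 1)) := by
          gcongr
          · linarith
          · exact (step2 i).trans (by gcongr)
      _ = _ := by field_simp; ring
  have step4 : ∑ i, ∫ z, |z.1 i - z.2 i| ∂γ ≤ Real.sqrt q * (∫ z, Real.sqrt (∑ i, (z.1 i - z.2 i) ^ 2) ∂γ) := by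
    rw [← integral_finsetSum _ (fun i _ => hint i), ← integral_const_mul]
    exact integral_mono (integrable_finsetSum _ (fun i _ => hint i)) (hintc.const_mul _) (fun z => l1_le q z.1 z.2)
  calc _ ≤ (1 / (Fintype.card (Fin q → Fin (N + 1)) : ℝ)) * ∑ a : Fin q → Fin (N+1),
      (1 : ℝ) / 2 ^ k * (2 * ∑ i, γ.real (S i (a i))) := by
        gcongr with a _
        exact step1 a
    _ = (2 / 2^k) * ∑ i, ((1 / (Fintype.card (Fin q → Fin (N + 1)) : ℝ)) * ∑ a : Fin q → Fin (N+1), γ.real (S i (a i))) := by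
        rw [← Finset.mul_sum, ← Finset.mul_sum, ← Finset.mul_sum, Finset.sum_comm]
        ring
    _ = (2 / 2^k) * ∑ i, ((1/((N:ℝ)+1)) * ∑ b, γ.real (S i b)) := by
        congr 1
        exact Finset.sum_congr rfl fun i _ => avg_aux q N (fun b => γ.real (S i b)) i
    _ ≤ (2 / 2^k) * ∑ i, (2 * 2^k * ((∫ z, |z.1 i - z.2 i| ∂γ) + 1 / N)) := by
        exact mul_le_mul_of_nonneg_left (Finset.sum_le_sum fun i _ => step3 i) (by positivity)
    _ = 4 * ((∑ i, ∫ z, |z.1 i - z.2 i| ∂γ) + q * (1 / (N:ℝ))) := by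
        rw [← Finset.mul_sum, Finset.sum_add_distrib]
        simp only [Finset.sum_const, Finset.card_univ, Fintype.card_fin, nsmul_eq_mul]
        field_simp; ring
    _ ≤ _ := by gcongr

/-- (Lemma of Indyk–Thaper on a grid.) Let `K = ⌈log₂(1/φ)⌉`,
`s = 2^{-(K+1)}`, and let `η` be uniform on the grid `{0, s, 2s, …}^q ∩ [0,1]^q`. Then for
all Borel probability measures `μ, ν` on `[0,1]^q`:
`E_η Σ_{k=1}^{K+1} 2^{−k} Σ_{C ∈ Q^k(η)} |μ(C) − ν(C)| ≤ (K+1)·4q·(W1(μ,ν)/√q + 2^{−(K+1)})`. -/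
theorem multiresolution_tv_le_w1 (q : ℕ) (φ : ℝ) (hφ : φ ∈ Set.Ioo (0 : ℝ) 1)
    (μ ν : Measure (Fin q → ℝ)) [IsProbabilityMeasure μ] [IsProbabilityMeasure ν]
    (hμ : μ (unitCube q) = 1) (hν : ν (unitCube q) = 1) :
    (1 / (Fintype.card (Fin q → Fin (2 ^ (⌈Real.logb 2 (1 / φ)⌉₊ + 1) + 1)) : ℝ)) *
      ∑ a : Fin q → Fin (2 ^ (⌈Real.logb 2 (1 / φ)⌉₊ + 1) + 1),
        ∑ k ∈ Finset.Icc 1 (⌈Real.logb 2 (1 / φ)⌉₊ + 1), (1 : ℝ) / 2 ^ k *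
          ∑' v : Fin q → ℤ,
            |(μ (gridCellQ q k (fun i => (a i : ℝ) / 2 ^ (⌈Real.logb 2 (1 / φ)⌉₊ + 1)) v)).toReal -
              (ν (gridCellQ q k (fun i => (a i : ℝ) / 2 ^ (⌈Real.logb 2 (1 / φ)⌉₊ + 1)) v)).toReal| ≤
      ((⌈Real.logb 2 (1 / φ)⌉₊ : ℝ) + 1) * 4 * q *
        (W1E q μ ν / Real.sqrt q + (1 : ℝ) / 2 ^ (⌈Real.logb 2 (1 / φ)⌉₊ + 1)) := by
  have hcoup : ∀ γ : Measure ((Fin q → ℝ) × (Fin q → ℝ)), IsProbabilityMeasure γ → IsCoupling γ μ ν →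
    (1 / (Fintype.card (Fin q → Fin (2 ^ (⌈Real.logb 2 (1 / φ)⌉₊ + 1) + 1)) : ℝ)) *
      ∑ a : Fin q → Fin (2 ^ (⌈Real.logb 2 (1 / φ)⌉₊ + 1) + 1),
        ∑ k ∈ Finset.Icc 1 (⌈Real.logb 2 (1 / φ)⌉₊ + 1), (1 : ℝ) / 2 ^ k *
          ∑' v : Fin q → ℤ,
            |(μ (gridCellQ q k (fun i => (a i : ℝ) / 2 ^ (⌈Real.logb 2 (1 / φ)⌉₊ + 1)) v)).toReal -
              (ν (gridCellQ q k (fun i => (a i : ℝ) / 2 ^ (⌈Real.logb 2 (1 / φ)⌉₊ + 1)) v)).toReal| ≤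
      ((⌈Real.logb 2 (1 / φ)⌉₊ : ℝ) + 1) * (4 * (Real.sqrt q * (∫ z, Real.sqrt (∑ i, (z.1 i - z.2 i) ^ 2) ∂γ)
        + q * (1 / 2 ^ (⌈Real.logb 2 (1 / φ)⌉₊ + 1)))) := by
    intro γ hγp hγ
    generalize ⌈Real.logb 2 (1 / φ)⌉₊ = K
    rw [Finset.sum_comm, Finset.mul_sum]
    have : ∀ k ∈ Finset.Icc 1 (K+1), _ := fun k hk =>
      level_bound q k (2^(K+1)) (2^(K+1-k)) (by positivity)
        (by rw [← pow_add]; congr 1; have := (Finset.mem_Icc.1 hk).2; omega) μ ν hμ hν γ hγ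
    push_cast at this
    push_cast
    refine (Finset.sum_le_sum this).trans (le_of_eq ?_)
    simp
  have hsq : (q:ℝ) / Real.sqrt q = Real.sqrt q := Real.div_sqrt
  generalize (1 / (Fintype.card (Fin q → Fin (2 ^ (⌈Real.logb 2 (1 / φ)⌉₊ + 1) + 1)) : ℝ)) *
      ∑ a : Fin q → Fin (2 ^ (⌈Real.logb 2 (1 / φ)⌉₊ + 1) + 1),
        ∑ k ∈ Finset.Icc 1 (⌈Real.logb 2 (1 / φ)⌉₊ + 1), (1 : ℝ) / 2 ^ k *
          ∑' v : Fin q → ℤ,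
            |(μ (gridCellQ q k (fun i => (a i : ℝ) / 2 ^ (⌈Real.logb 2 (1 / φ)⌉₊ + 1)) v)).toReal -
              (ν (gridCellQ q k (fun i => (a i : ℝ) / 2 ^ (⌈Real.logb 2 (1 / φ)⌉₊ + 1)) v)).toReal| = L at hcoup ⊢
  generalize (1:ℝ) / 2 ^ (⌈Real.logb 2 (1 / φ)⌉₊ + 1) = B at hcoup ⊢
  generalize ⌈Real.logb 2 (1 / φ)⌉₊ = K at hcoup ⊢
  have hprod : IsCoupling (μ.prod ν) μ ν := by
    constructor
    · simp
    · simp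
  have hR : ((K:ℝ) + 1) * 4 * q * (W1E q μ ν / Real.sqrt q + B) =
      ((K:ℝ)+1) * (4 * (Real.sqrt q * W1E q μ ν + q * B)) := by
    linear_combination ((K:ℝ)+1) * 4 * W1E q μ ν * hsq
  rw [hR]
  rcases Nat.eq_zero_or_pos q with rfl | hq
  · simpa using hcoup _ inferInstance hprod
  have hs : 0 < Real.sqrt q := Real.sqrt_pos.2 (by exact_mod_cast hq)
  have hK : (0:ℝ) < (K:ℝ)+1 := by positivity
  have hW : (L / (((K:ℝ)+1) * 4) - q * B) / Real.sqrt q ≤ W1E q μ ν := by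
    apply le_csInf
    · exact ⟨_, μ.prod ν, inferInstance, hprod, rfl⟩
    · rintro c ⟨γ, h1, h2, rfl⟩
      have := hcoup γ h1 h2
      rw [div_le_iff₀ hs, sub_le_iff_le_add, div_le_iff₀ (by positivity)]
      linarith
  rw [div_le_iff₀ hs, sub_le_iff_le_add, div_le_iff₀ (by positivity)] at hW
  linarith

end
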